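/- Let p be a prime and c₀, c₁, c₂ ∈ ℤ/p with at least two of them nonzero. If for every unit i ∈ (ℤ/p)ˣ one has r_p(i·c₀) + r_p(i·c₁) + r_p(i·c₂) > p, where r_p(x) denotes the least nonnegative residue of x modulo p, then there exist a permutation σ of {0,1,2} and elements k, a ∈ ℤ/p with k ≠ 0 and a ≠ 0 such that c_{σ(0)} = k, c_{σ(1)} = a and c_{σ(2)} = −a. (This is the classification in case (1) of the paper's final Proposition: the pair (𝔸³,α) is b-terminal precisely when c > p, in which case (c₀,c₁,c₂) ≡ (k, a, p−a) (mod p) for some k, a ≢ 0, up to permutation.) -/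

import Mathlib

/-- If `b + 1 = x + y` with `2 * b < p` and `⌊i b / p⌋ = ⌊i x / p⌋ + ⌊i y / p⌋` for all `i < p`,
then `x` or `y` is `1`: otherwise the jumps of the smaller of `x`, `y` would come too close to
those of the larger one. -/
lemma eq_one_or_eq_one_of_mul_div_eq {p b x y : ℕ} (hx : 0 < x) (hy : 0 < y)
    (hb : b + 1 = x + y) (hbp : 2 * b < p)
    (h : ∀ i < p, i * b / p = i * x / p + i * y / p) : x = 1 ∨ y = 1 := by
  wlog hxy : x ≤ y generalizing x y
  · exact (this hy hx (by omega) (fun i hi => by rw [h i hi, add_comm]) (by omega)).symm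
  by_contra! hne
  have hp : 0 < p := by omega
  have hb2 : 2 < b + 1 := by omega
  obtain ⟨q, hq⟩ : ∃ q, q = (p - 1) / b := ⟨_, rfl⟩
  obtain ⟨m, hm⟩ : ∃ m, m = (p - 1) / x := ⟨_, rfl⟩
  have hq1 : q * b ≤ p - 1 := hq ▸ Nat.div_mul_le_self _ _
  have hm1 : m * x ≤ p - 1 := hm ▸ Nat.div_mul_le_self _ _
  have hq2 : p ≤ (q + 1) * b := by
    have := Nat.lt_div_mul_add (a := p - 1) (b := b) (by omega)
    rw [← hq] at this
    nlinarith [Nat.sub_add_cancel hp]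
  have hm2 : p ≤ (m + 1) * x := by
    have := Nat.lt_div_mul_add (a := p - 1) (b := x) hx
    rw [← hm] at this
    nlinarith [Nat.sub_add_cancel hp]
  have hqge : 2 ≤ q := hq ▸ (Nat.le_div_iff_mul_le (by omega)).2 (by omega)
  have hmq : q ≤ m := hq ▸ hm ▸ Nat.div_le_div_left (by omega) hx
  have hqle : q * 2 ≤ p - 1 := (Nat.mul_le_mul_left q (by omega)).trans hq1
  have hmle : m * 2 ≤ p - 1 := (Nat.mul_le_mul_left m (by omega)).trans hm1
  have hfx : m * x / p = 0 := Nat.div_eq_of_lt (by omega)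
  have hfx' : 1 ≤ (m + 1) * x / p := (Nat.one_le_div_iff hp).2 hm2
  have hmono : ∀ z i j : ℕ, i ≤ j → i * z / p ≤ j * z / p := fun z i j hij =>
    Nat.div_le_div_right (Nat.mul_le_mul_right z hij)
  have hgap : ∀ i, (i + q) * b / p ≤ i * b / p + 1 := by
    intro i
    rw [← Nat.add_div_right _ hp]
    exact Nat.div_le_div_right (by rw [add_mul]; omega)
  have hy2 : p ≤ (q + 1) * y := by
    have h1 : 1 ≤ (q + 1) * b / p := (Nat.one_le_div_iff hp).2 hq2
    rw [h (q + 1) (by omega)] at h1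
    have h2 : (q + 1) * x / p ≤ (q + 1) * y / p :=
      Nat.div_le_div_right (Nat.mul_le_mul_left _ hxy)
    exact (Nat.one_le_div_iff hp).1 (by omega)
  have hjump : ∀ i, i * y / p + 1 ≤ (i + (q + 1)) * y / p := by
    intro i
    rw [← Nat.add_div_right _ hp]
    exact Nat.div_le_div_right (by rw [add_mul i]; omega)
  obtain ⟨n, hn⟩ : ∃ n, m + 1 = n + q := ⟨m + 1 - q, by omega⟩
  have e1 := hgap n
  rw [← hn, h (m + 1) (by omega), h n (by omega)] at e1
  have e2 := hgap m
  rw [h (m + q) (by omega), h m (by omega)] at e2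
  have e3 := hjump n
  have m1 := hmono x n m (by omega)
  have m2 := hmono x (m + 1) (m + q) (by omega)
  have m3 := hmono y m (m + 1) (by omega)
  have m4 := hmono y (n + (q + 1)) (m + q) (by omega)
  omega

lemma mul_mod_ne_zero_of_prime {p : ℕ} (hp : p.Prime) {i a : ℕ} (hi : 0 < i) (hip : i < p)
    (ha : 0 < a) (hap : a < p) : i * a % p ≠ 0 := by
  intro h
  rcases hp.dvd_mul.1 (Nat.dvd_of_mod_eq_zero h) with h | h
  · exact absurd (Nat.le_of_dvd hi h) (by omega)
  · exact absurd (Nat.le_of_dvd ha h) (by omega)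

lemma mul_div_add_mul_sub_div {p : ℕ} (hp : p.Prime) {i a : ℕ} (hi : 0 < i) (hip : i < p)
    (ha : 0 < a) (hap : a < p) : i * a / p + i * (p - a) / p + 1 = i := by
  have h1 := Nat.div_add_mod (i * a) p
  have h2 := Nat.div_add_mod (i * (p - a)) p
  have h3 := Nat.mod_lt (i * a) hp.pos
  have h4 := Nat.mod_lt (i * (p - a)) hp.pos
  have h5 := Nat.pos_of_ne_zero (mul_mod_ne_zero_of_prime hp hi hip ha hap)
  have h6 : i * a + i * (p - a) = p * i := by
    rw [← mul_add, Nat.add_sub_cancel' hap.le, mul_comm]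
  refine le_antisymm ?_ ?_
  · refine Nat.succ_le_of_lt (Nat.lt_of_mul_lt_mul_left (a := p) ?_)
    rw [mul_add]
    omega
  · refine Nat.le_of_lt_succ (Nat.lt_of_mul_lt_mul_left (a := p) ?_)
    rw [Nat.mul_succ, mul_add, mul_add]
    omega

/-- If one of the three residues is less than `p / 2` and the others are larger, then one of the
larger ones is `p - 1`. -/
lemma add_eq_of_mul_div_sum_of_lt {p : ℕ} (hp : p.Prime) {a b c : ℕ}
    (hb : 0 < b) (hbp : b < p) (hc : 0 < c) (hcp : c < p) (hap : 2 * a < p)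
    (hsum : a + b + c + 1 = 2 * p)
    (h : ∀ i, 0 < i → i < p → i * a / p + i * b / p + i * c / p + 2 = 2 * i) :
    a + b = p ∨ a + c = p := by
  have key := eq_one_or_eq_one_of_mul_div_eq (p := p) (b := a) (x := p - b) (y := p - c)
    (by omega) (by omega) (by omega) hap ?_
  · omega
  · intro i hip
    rcases Nat.eq_zero_or_pos i with rfl | hi
    · simp
    · have h1 := mul_div_add_mul_sub_div hp hi hip hb hbp
      have h2 := mul_div_add_mul_sub_div hp hi hip hc hcp
      have h3 := h i hi hip
      omega

lemma exists_add_eq_of_mul_mod_sum {p : ℕ} (hp : p.Prime) (hp2 : 2 < p) {a b c : ℕ}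
    (ha : 0 < a) (hap : a < p) (hb : 0 < b) (hbp : b < p) (hc : 0 < c) (hcp : c < p)
    (h : ∀ i, 0 < i → i < p → i * a % p + i * b % p + i * c % p + i = 2 * p) :
    a + b = p ∨ a + c = p ∨ b + c = p := by
  have hsum : a + b + c + 1 = 2 * p := by
    simpa [Nat.mod_eq_of_lt, hap, hbp, hcp] using h 1 one_pos (by omega)
  have hdiv : ∀ i, 0 < i → i < p → i * a / p + i * b / p + i * c / p + 2 = 2 * i := by
    intro i hi hip
    have h0 := h i hi hip
    have h1 := Nat.div_add_mod (i * a) p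
    have h2 := Nat.div_add_mod (i * b) p
    have h3 := Nat.div_add_mod (i * c) p
    have h4 : i * a + i * b + i * c + i = p * (2 * i) := by
      linear_combination i * hsum
    refine Nat.eq_of_mul_eq_mul_left hp.pos ?_
    linarith
  have hsmall : 2 * a < p ∨ 2 * b < p ∨ 2 * c < p := by
    by_contra! hcon
    have h2 := hdiv 2 two_pos hp2
    have := (Nat.one_le_div_iff hp.pos).2 hcon.1
    have := (Nat.one_le_div_iff hp.pos).2 hcon.2.1
    have := (Nat.one_le_div_iff hp.pos).2 hcon.2.2
    omega
  rcases hsmall with hs | hs | hs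
  · have := add_eq_of_mul_div_sum_of_lt hp hb hbp hc hcp hs hsum hdiv
    omega
  · have := add_eq_of_mul_div_sum_of_lt hp ha hap hc hcp hs (by omega)
      (fun i hi hip => by have := hdiv i hi hip; omega)
    omega
  · have := add_eq_of_mul_div_sum_of_lt hp ha hap hb hbp hs (by omega)
      (fun i hi hip => by have := hdiv i hi hip; omega)
    omega

lemma ZMod.val_neg_add_val {n : ℕ} [NeZero n] {a : ZMod n} (ha : a ≠ 0) :
    (-a).val + a.val = n := by
  have : NeZero a := ⟨ha⟩
  rw [ZMod.val_neg_of_ne_zero]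
  exact Nat.sub_add_cancel a.val_lt.le

lemma ZMod.two_add_eq_zero : ∀ a b : ZMod 2, a ≠ 0 → b ≠ 0 → a + b = 0 := by decide

section

variable {p : ℕ} [Fact p.Prime] {c : Fin 3 → ZMod p}

lemma ne_zero_of_lt_sum_val
    (h : ∀ i : (ZMod p)ˣ, p < ∑ j, ((i : ZMod p) * c j).val) (j : Fin 3) : c j ≠ 0 := by
  have h1 := h 1
  have h2 := h (-1)
  simp only [Fin.sum_univ_three, Units.val_one, Units.val_neg, one_mul, neg_mul] at h1 h2
  have hle : ∀ a : ZMod p, (-a).val + a.val ≤ p := by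
    intro a
    by_cases ha : a = 0
    · simp [ha]
    · exact (ZMod.val_neg_add_val ha).le
  have h3 := hle (c 0)
  have h4 := hle (c 1)
  have h5 := hle (c 2)
  intro hj
  fin_cases j <;> simp only [Fin.zero_eta, Fin.mk_one, Fin.reduceFinMk] at hj <;>
    simp only [hj, neg_zero, ZMod.val_zero] at h1 h2 <;> omega

lemma sum_val_lt_two_mul (hc : ∀ j, c j ≠ 0)
    (h : ∀ i : (ZMod p)ˣ, p < ∑ j, ((i : ZMod p) * c j).val) (i : (ZMod p)ˣ) :
    ∑ j, ((i : ZMod p) * c j).val < 2 * p := by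
  have h1 := h (-i)
  have h2 : ∀ j, (-((i : ZMod p) * c j)).val + ((i : ZMod p) * c j).val = p := fun j =>
    ZMod.val_neg_add_val (mul_ne_zero i.ne_zero (hc j))
  have h3 := h2 0
  have h4 := h2 1
  have h5 := h2 2
  simp only [Fin.sum_univ_three, Units.val_neg, neg_mul] at h1 ⊢
  omega

lemma sum_ne_zero_of_lt_sum_val (hc : ∀ j, c j ≠ 0)
    (h : ∀ i : (ZMod p)ˣ, p < ∑ j, ((i : ZMod p) * c j).val) : ∑ j, c j ≠ 0 := by
  intro hs
  have h1 := h 1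
  have h2 := sum_val_lt_two_mul hc h 1
  simp only [Units.val_one, one_mul] at h1 h2
  have h3 : p ∣ ∑ j, (c j).val := by
    rw [← ZMod.natCast_eq_zero_iff]
    simpa using hs
  obtain ⟨k, hk⟩ := h3
  rw [hk] at h1 h2
  have h4 : 1 < k := Nat.lt_of_mul_lt_mul_left (a := p) (by omega)
  have h5 : k < 2 := Nat.lt_of_mul_lt_mul_left (a := p) (by omega)
  omega

lemma exists_add_eq_zero_of_sum_eq_neg_one (hp2 : 2 < p) (hc : ∀ j, c j ≠ 0)
    (hs : ∑ j, c j = -1)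
    (h : ∀ i : (ZMod p)ˣ, p < ∑ j, ((i : ZMod p) * c j).val) :
    c 0 + c 1 = 0 ∨ c 0 + c 2 = 0 ∨ c 1 + c 2 = 0 := by
  have hpos : ∀ j, 0 < (c j).val := fun j => ZMod.val_pos.2 (hc j)
  have hcast : ∀ a b : ZMod p, a.val + b.val = p → a + b = 0 := by
    intro a b hab
    simpa using congrArg (Nat.cast : ℕ → ZMod p) hab
  have key := exists_add_eq_of_mul_mod_sum (Fact.out : p.Prime) hp2
    (hpos 0) (c 0).val_lt (hpos 1) (c 1).val_lt (hpos 2) (c 2).val_lt ?_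
  · exact key.imp (hcast _ _) (Or.imp (hcast _ _) (hcast _ _))
  intro i hi hip
  have hi0 : (i : ZMod p) ≠ 0 := by
    rw [Ne, ZMod.natCast_eq_zero_iff]
    exact Nat.not_dvd_of_pos_of_lt hi hip
  have h1 := h (Units.mk0 _ hi0)
  have h2 := sum_val_lt_two_mul hc h (Units.mk0 _ hi0)
  have h3 : p ∣ ∑ j, ((i : ZMod p) * c j).val + i := by
    rw [← ZMod.natCast_eq_zero_iff]
    simp only [Nat.cast_add, Nat.cast_sum, ZMod.natCast_val, ZMod.cast_id', id_eq]
    rw [← Finset.mul_sum, hs]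
    ring
  obtain ⟨k, hk⟩ := h3
  simp only [Units.val_mk0] at h1 h2
  have h4 : 1 < k := Nat.lt_of_mul_lt_mul_left (a := p) (by omega)
  have h5 : k < 3 := Nat.lt_of_mul_lt_mul_left (a := p) (by omega)
  obtain rfl : k = 2 := by omega
  simp only [Fin.sum_univ_three, ZMod.val_mul, ZMod.val_natCast, Nat.mod_eq_of_lt hip] at hk
  omega

lemma exists_add_eq_zero_of_lt_sum_val (hc : ∀ j, c j ≠ 0)
    (h : ∀ i : (ZMod p)ˣ, p < ∑ j, ((i : ZMod p) * c j).val) :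
    c 0 + c 1 = 0 ∨ c 0 + c 2 = 0 ∨ c 1 + c 2 = 0 := by
  rcases (Fact.out : p.Prime).two_le.eq_or_lt with rfl | hp2
  · exact Or.inl (ZMod.two_add_eq_zero _ _ (hc 0) (hc 1))
  have hs := sum_ne_zero_of_lt_sum_val hc h
  obtain ⟨u, hu⟩ : ∃ u : (ZMod p)ˣ, (u : ZMod p) = -(∑ j, c j)⁻¹ :=
    ⟨Units.mk0 _ (neg_ne_zero.2 (inv_ne_zero hs)), rfl⟩
  have key := exists_add_eq_zero_of_sum_eq_neg_one (c := fun j => (u : ZMod p) * c j) hp2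
    (fun j => mul_ne_zero u.ne_zero (hc j))
    (by rw [← Finset.mul_sum, hu, neg_mul, inv_mul_cancel₀ hs])
    (fun i => by simpa [mul_assoc] using h (i * u))
  simpa [← mul_add] using key

end

/-- The b-terminal case: if at least two of `c 0, c 1, c 2 ∈ ℤ/p` are nonzero
and for every unit `i` the least nonnegative residues of `i·c j` sum to more
than `p`, then up to permutation `(c₀, c₁, c₂) = (k, a, -a)` with `k, a ≠ 0`. -/
theorem b_terminal_case_classification
    (p : ℕ) (hp : p.Prime) (c : Fin 3 → ZMod p)
    (htwo : ∃ j j' : Fin 3, j ≠ j' ∧ c j ≠ 0 ∧ c j' ≠ 0)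
    (h : ∀ i : (ZMod p)ˣ, p < ∑ j, ((i : ZMod p) * c j).val) :
    ∃ (σ : Equiv.Perm (Fin 3)) (k a : ZMod p), k ≠ 0 ∧ a ≠ 0 ∧
      c (σ 0) = k ∧ c (σ 1) = a ∧ c (σ 2) = -a := by
  have : Fact p.Prime := ⟨hp⟩
  have hc := ne_zero_of_lt_sum_val h
  rcases exists_add_eq_zero_of_lt_sum_val hc h with h0 | h0 | h0
  · exact ⟨Equiv.swap 0 2, c 2, c 1, hc 2, hc 1, rfl, rfl, eq_neg_of_add_eq_zero_left h0⟩
  · exact ⟨Equiv.swap 0 1, c 1, c 0, hc 1, hc 0, rfl, rfl, eq_neg_of_add_eq_zero_right h0⟩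
  · exact ⟨1, c 0, c 1, hc 0, hc 1, rfl, rfl, eq_neg_of_add_eq_zero_right h0⟩
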